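/- Let u, η : ℝ × ℝ → ℝ be smooth functions of (x,t) solving the two-component Hunter-Saxton equation u_xt = 2u·u_xx + u_x² − η² and η_t = 2·∂_x(u·η), and assume u_x² + η² is nowhere zero. Define α̃₁ = η²·(u_x² + η²)^{−2}, β̃₁ = u_x·(u_x² + η²)^{−1}, and recursively α̃_{k+1} = (u_x² + η²)^{−1}·∂_x α̃_k, β̃_{k+1} = (u_x² + η²)^{−1}·∂_x β̃_k for k ≥ 1. Then for any n ≥ 1 and any smooth function G₁ : ℝ^{2n−1} → ℝ, the function F = (u_x² + η²)·G₁(α̃₁, α̃₂, β̃₂, …, α̃_n, β̃_n) satisfies the conservation law ∂_t F = ∂_x(2u·F) at every point. -/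

import Mathlib

/-- Partial derivative with respect to the first variable `x`. -/
noncomputable def pdx (f : ℝ × ℝ → ℝ) (p : ℝ × ℝ) : ℝ := deriv (fun x => f (x, p.2)) p.1

/-- Partial derivative with respect to the second variable `t`. -/
noncomputable def pdt (f : ℝ × ℝ → ℝ) (p : ℝ × ℝ) : ℝ := deriv (fun t => f (p.1, t)) p.2

open scoped ContDiff

section PartialDerivatives

variable {f : ℝ × ℝ → ℝ}

theorem hasDerivAt_pdx (hf : ContDiff ℝ ∞ f) (p : ℝ × ℝ) :
    HasDerivAt (fun x => f (x, p.2)) (pdx f p) p.1 := by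
  have h : Differentiable ℝ fun x => f (x, p.2) :=
    (hf.comp (contDiff_id.prodMk contDiff_const)).differentiable (by simp)
  exact (h p.1).hasDerivAt

theorem hasDerivAt_pdt (hf : ContDiff ℝ ∞ f) (p : ℝ × ℝ) :
    HasDerivAt (fun t => f (p.1, t)) (pdt f p) p.2 := by
  have h : Differentiable ℝ fun t => f (p.1, t) :=
    (hf.comp (contDiff_const.prodMk contDiff_id)).differentiable (by simp)
  exact (h p.2).hasDerivAt

theorem pdx_eq_fderiv (hf : ContDiff ℝ ∞ f) : pdx f = fun p => fderiv ℝ f p (1, 0) := by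
  funext p
  have h : HasFDerivAt f (fderiv ℝ f p) (p.1, p.2) :=
    (hf.differentiable (by simp) p).hasFDerivAt
  exact (h.comp_hasDerivAt p.1 ((hasDerivAt_id p.1).prodMk (hasDerivAt_const p.1 p.2))).deriv

theorem pdt_eq_fderiv (hf : ContDiff ℝ ∞ f) : pdt f = fun p => fderiv ℝ f p (0, 1) := by
  funext p
  have h : HasFDerivAt f (fderiv ℝ f p) (p.1, p.2) :=
    (hf.differentiable (by simp) p).hasFDerivAt
  exact (h.comp_hasDerivAt p.2 ((hasDerivAt_const p.2 p.1).prodMk (hasDerivAt_id p.2))).deriv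

theorem contDiff_fderiv_apply_const (hf : ContDiff ℝ ∞ f) (v : ℝ × ℝ) :
    ContDiff ℝ ∞ fun p => fderiv ℝ f p v :=
  (hf.fderiv_right (m := ∞) (by simp)).clm_apply contDiff_const

theorem ContDiff.pdx (hf : ContDiff ℝ ∞ f) : ContDiff ℝ ∞ (pdx f) := by
  rw [pdx_eq_fderiv hf]
  exact contDiff_fderiv_apply_const hf _

theorem ContDiff.pdt (hf : ContDiff ℝ ∞ f) : ContDiff ℝ ∞ (pdt f) := by
  rw [pdt_eq_fderiv hf]
  exact contDiff_fderiv_apply_const hf _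

theorem pdt_pdx_comm (hf : ContDiff ℝ ∞ f) (p : ℝ × ℝ) : pdt (pdx f) p = pdx (pdt f) p := by
  rw [pdt_eq_fderiv hf.pdx, pdx_eq_fderiv hf.pdt, pdx_eq_fderiv hf, pdt_eq_fderiv hf]
  have hd : DifferentiableAt ℝ (fderiv ℝ f) p :=
    (hf.fderiv_right (m := ∞) (by simp)).differentiable (by simp) p
  have hsymm : IsSymmSndFDerivAt ℝ f p := hf.contDiffAt.isSymmSndFDerivAt (by
    rw [minSmoothness_of_isRCLikeNormedField]
    exact WithTop.coe_le_coe.2 (le_top : (2 : ℕ∞) ≤ ⊤))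
  have happly (v w : ℝ × ℝ) :
      fderiv ℝ (fun q => fderiv ℝ f q v) p w = fderiv ℝ (fderiv ℝ f) p w v := by
    rw [fderiv_clm_apply hd (differentiableAt_const v)]
    simp
  simp only [happly]
  exact hsymm _ _

end PartialDerivatives

section Transport

variable {u w f : ℝ × ℝ → ℝ}

/-- If `w` is a nonvanishing density of the transport operator `∂_t - 2u∂_x`, then `w⁻¹ ∂_x`
maps functions on which this operator is constant to functions it annihilates. -/
theorem pdt_inv_mul_pdx_eq (hu : ContDiff ℝ ∞ u) (hw : ContDiff ℝ ∞ w) (hf : ContDiff ℝ ∞ f)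
    (hne : ∀ p, w p ≠ 0) (hwt : ∀ p, pdt w p = 2 * u p * pdx w p + 2 * pdx u p * w p)
    {c : ℝ} (hft : ∀ p, pdt f p = 2 * u p * pdx f p + c) (p : ℝ × ℝ) :
    pdt (fun q => (w q)⁻¹ * pdx f q) p = 2 * u p * pdx (fun q => (w q)⁻¹ * pdx f q) p := by
  have ht := ((hasDerivAt_pdt hw p).fun_inv (hne p)).mul (hasDerivAt_pdt hf.pdx p)
  have hx := ((hasDerivAt_pdx hw p).fun_inv (hne p)).mul (hasDerivAt_pdx hf.pdx p)
  have hmix : pdt (pdx f) p = 2 * pdx u p * pdx f p + 2 * u p * pdx (pdx f) p := by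
    rw [pdt_pdx_comm hf, funext hft]
    exact ((((hasDerivAt_pdx hu p).const_mul 2).mul (hasDerivAt_pdx hf.pdx p)).add_const c).deriv
  have hpt : pdt (fun q => (w q)⁻¹ * pdx f q) p = _ := ht.deriv
  have hpx : pdx (fun q => (w q)⁻¹ * pdx f q) p = _ := hx.deriv
  rw [hpt, hpx, hmix, hwt]
  have := hne p
  field_simp
  ring

/-- Composites of smooth functions with functions annihilated by `∂_t - 2u∂_x` are annihilated. -/
theorem pdt_comp_eq {ι : Type*} [Fintype ι] {G : (ι → ℝ) → ℝ} (hG : ContDiff ℝ ∞ G)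
    {a : ι → ℝ × ℝ → ℝ} (ha : ∀ i, ContDiff ℝ ∞ (a i))
    (hat : ∀ i p, pdt (a i) p = 2 * u p * pdx (a i) p) (p : ℝ × ℝ) :
    pdt (fun q => G fun i => a i q) p = 2 * u p * pdx (fun q => G fun i => a i q) p := by
  have hGd : HasFDerivAt G (fderiv ℝ G fun i => a i p) fun i => a i (p.1, p.2) :=
    (hG.differentiable (by simp) _).hasFDerivAt
  have ht : pdt (fun q => G fun i => a i q) p = _ :=
    (hGd.comp_hasDerivAt p.2 (hasDerivAt_pi.2 fun i => hasDerivAt_pdt (ha i) p)).deriv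
  have hx : pdx (fun q => G fun i => a i q) p = _ :=
    (hGd.comp_hasDerivAt p.1 (hasDerivAt_pi.2 fun i => hasDerivAt_pdx (ha i) p)).deriv
  have hsmul : (fun i => pdt (a i) p) = (2 * u p) • fun i => pdx (a i) p :=
    funext fun i => hat i p
  rw [ht, hx, hsmul, map_smul, smul_eq_mul]

/-- The product of a density of `∂_t - 2u∂_x` with a function annihilated by this operator
satisfies the conservation law with flux `2u`. -/
theorem pdt_mul_eq_pdx (hu : ContDiff ℝ ∞ u) (hw : ContDiff ℝ ∞ w) (hf : ContDiff ℝ ∞ f)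
    (hwt : ∀ p, pdt w p = 2 * u p * pdx w p + 2 * pdx u p * w p)
    (hft : ∀ p, pdt f p = 2 * u p * pdx f p) (p : ℝ × ℝ) :
    pdt (fun q => w q * f q) p = pdx (fun q => 2 * u q * (w q * f q)) p := by
  have ht : pdt (fun q => w q * f q) p = _ :=
    ((hasDerivAt_pdt hw p).mul (hasDerivAt_pdt hf p)).deriv
  have hx : pdx (fun q => 2 * u q * (w q * f q)) p = _ :=
    (((hasDerivAt_pdx hu p).const_mul 2).mul
      ((hasDerivAt_pdx hw p).mul (hasDerivAt_pdx hf p))).deriv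
  rw [ht, hx, hwt, hft]
  simp only [Pi.mul_apply]
  ring

/-- Every iterate of `w⁻¹ ∂_x` after the first, applied to a smooth function on which
`∂_t - 2u∂_x` is constant, is smooth and annihilated by `∂_t - 2u∂_x`. -/
theorem contDiff_and_pdt_eq_of_rec (hu : ContDiff ℝ ∞ u) (hw : ContDiff ℝ ∞ w)
    (hne : ∀ p, w p ≠ 0) (hwt : ∀ p, pdt w p = 2 * u p * pdx w p + 2 * pdx u p * w p)
    {a : ℕ → ℝ × ℝ → ℝ} (hrec : ∀ k, 1 ≤ k → ∀ p, a (k + 1) p = (w p)⁻¹ * pdx (a k) p)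
    (ha : ContDiff ℝ ∞ (a 1)) {c : ℝ} (hat : ∀ p, pdt (a 1) p = 2 * u p * pdx (a 1) p + c)
    (k : ℕ) :
    ContDiff ℝ ∞ (a (k + 2)) ∧ ∀ p, pdt (a (k + 2)) p = 2 * u p * pdx (a (k + 2)) p := by
  induction k with
  | zero =>
    rw [funext (hrec 1 le_rfl)]
    exact ⟨(hw.inv hne).mul ha.pdx, pdt_inv_mul_pdx_eq hu hw ha hne hwt hat⟩
  | succ k ih =>
    rw [funext (hrec (k + 2) (by omega))]
    exact ⟨(hw.inv hne).mul ih.1.pdx, pdt_inv_mul_pdx_eq hu hw ih.1 hne hwt (c := 0)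
      (by simpa using ih.2)⟩

end Transport

theorem twoComponentHunterSaxton_conserved_density (u η : ℝ × ℝ → ℝ)
    (hu : ContDiff ℝ (⊤ : ℕ∞) u) (hη : ContDiff ℝ (⊤ : ℕ∞) η)
    (hequ : ∀ p : ℝ × ℝ,
      pdt (fun q => pdx u q) p = 2 * u p * pdx (fun q => pdx u q) p + (pdx u p) ^ 2 - (η p) ^ 2)
    (heqη : ∀ p : ℝ × ℝ, pdt η p = 2 * pdx (fun q => u q * η q) p)
    (hne : ∀ p : ℝ × ℝ, (pdx u p) ^ 2 + (η p) ^ 2 ≠ 0)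
    (n : ℕ) (hn : 1 ≤ n)
    (G₁ : (Fin (2 * n - 1) → ℝ) → ℝ) (hG : ContDiff ℝ (⊤ : ℕ∞) G₁)
    (α β : ℕ → ℝ × ℝ → ℝ)
    (hα1 : ∀ p : ℝ × ℝ, α 1 p = (η p) ^ 2 * (((pdx u p) ^ 2 + (η p) ^ 2) ^ 2)⁻¹)
    (hβ1 : ∀ p : ℝ × ℝ, β 1 p = pdx u p * ((pdx u p) ^ 2 + (η p) ^ 2)⁻¹)
    (hαrec : ∀ k, 1 ≤ k → ∀ p : ℝ × ℝ,
      α (k + 1) p = ((pdx u p) ^ 2 + (η p) ^ 2)⁻¹ * pdx (α k) p)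
    (hβrec : ∀ k, 1 ≤ k → ∀ p : ℝ × ℝ,
      β (k + 1) p = ((pdx u p) ^ 2 + (η p) ^ 2)⁻¹ * pdx (β k) p) :
    ∀ p : ℝ × ℝ,
      pdt (fun q => ((pdx u q) ^ 2 + (η q) ^ 2) *
      G₁ (fun i => if i.val = 0 then α 1 q
          else if i.val % 2 = 1 then α (i.val / 2 + 2) q
          else β (i.val / 2 + 1) q)) p
        = pdx (fun q => 2 * u q * ((fun q => ((pdx u q) ^ 2 + (η q) ^ 2) *
      G₁ (fun i => if i.val = 0 then α 1 q
          else if i.val % 2 = 1 then α (i.val / 2 + 2) q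
          else β (i.val / 2 + 1) q)) q)) p := by
  have hux : ContDiff ℝ ∞ (pdx u) := hu.pdx
  set w : ℝ × ℝ → ℝ := fun q => (pdx u q) ^ 2 + (η q) ^ 2 with hw_def
  have hw : ContDiff ℝ ∞ w := (hux.pow 2).add (hη.pow 2)
  have hηt (p : ℝ × ℝ) : pdt η p = 2 * (pdx u p * η p + u p * pdx η p) := by
    rw [heqη]
    exact congrArg (2 * ·) ((hasDerivAt_pdx hu p).mul (hasDerivAt_pdx hη p)).deriv
  have hwx (p : ℝ × ℝ) : pdx w p = 2 * pdx u p * pdx (pdx u) p + 2 * η p * pdx η p := by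
    have h : pdx w p = _ :=
      (((hasDerivAt_pdx hux p).pow 2).add ((hasDerivAt_pdx hη p).pow 2)).deriv
    simpa using h
  have hwt (p : ℝ × ℝ) : pdt w p = 2 * u p * pdx w p + 2 * pdx u p * w p := by
    have h : pdt w p = _ :=
      (((hasDerivAt_pdt hux p).pow 2).add ((hasDerivAt_pdt hη p).pow 2)).deriv
    have hequ' : pdt (pdx u) p = _ := hequ p
    rw [h, hwx, hequ', hηt]
    simp only [hw_def]
    norm_num
    ring
  have hαs : ContDiff ℝ ∞ (α 1) := by
    rw [funext hα1]
    exact (hη.pow 2).mul ((hw.pow 2).inv fun p => pow_ne_zero 2 (hne p))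
  have hβs : ContDiff ℝ ∞ (β 1) := by
    rw [funext hβ1]
    exact hux.mul (hw.inv hne)
  have hαt (p : ℝ × ℝ) : pdt (α 1) p = 2 * u p * pdx (α 1) p := by
    rw [funext hα1]
    have hwp : w p ≠ 0 := hne p
    have ht : pdt (fun q => η q ^ 2 * (w q ^ 2)⁻¹) p = _ :=
      (((hasDerivAt_pdt hη p).pow 2).mul
        (((hasDerivAt_pdt hw p).fun_pow 2).fun_inv (pow_ne_zero 2 hwp))).deriv
    have hx : pdx (fun q => η q ^ 2 * (w q ^ 2)⁻¹) p = _ :=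
      (((hasDerivAt_pdx hη p).pow 2).mul
        (((hasDerivAt_pdx hw p).fun_pow 2).fun_inv (pow_ne_zero 2 hwp))).deriv
    refine ht.trans (Eq.trans ?_ (congrArg (2 * u p * ·) hx).symm)
    simp only [hwt, hηt, Pi.pow_apply]
    field_simp
    norm_num
    ring
  have hβt (p : ℝ × ℝ) : pdt (β 1) p = 2 * u p * pdx (β 1) p + -1 := by
    rw [funext hβ1]
    have hwp : w p ≠ 0 := hne p
    have ht : pdt (fun q => pdx u q * (w q)⁻¹) p = _ :=
      ((hasDerivAt_pdt hux p).mul ((hasDerivAt_pdt hw p).fun_inv hwp)).deriv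
    have hx : pdx (fun q => pdx u q * (w q)⁻¹) p = _ :=
      ((hasDerivAt_pdx hux p).mul ((hasDerivAt_pdx hw p).fun_inv hwp)).deriv
    have hequ' : pdt (pdx u) p = _ := hequ p
    refine ht.trans (Eq.trans ?_ (congrArg (2 * u p * · + -1) hx).symm)
    have hwη : η p ^ 2 = w p - pdx u p ^ 2 := by simp [hw_def]
    simp only [hwt, hequ', hwη]
    field_simp
    ring
  have hα := contDiff_and_pdt_eq_of_rec hu hw hne hwt hαrec hαs (c := 0) (by simpa using hαt)
  have hβ := contDiff_and_pdt_eq_of_rec hu hw hne hwt hβrec hβs hβt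
  let a : Fin (2 * n - 1) → ℝ × ℝ → ℝ := fun i q =>
    if i.val = 0 then α 1 q
    else if i.val % 2 = 1 then α (i.val / 2 + 2) q
    else β (i.val / 2 + 1) q
  have ha (i : Fin (2 * n - 1)) :
      ContDiff ℝ ∞ (a i) ∧ ∀ p, pdt (a i) p = 2 * u p * pdx (a i) p := by
    by_cases h0 : i.val = 0
    · have hai : a i = α 1 := funext fun q => if_pos h0
      rw [hai]
      exact ⟨hαs, hαt⟩
    by_cases h1 : i.val % 2 = 1
    · have hai : a i = α (i.val / 2 + 2) := by simp only [a, if_neg h0, if_pos h1]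
      rw [hai]
      exact hα _
    · have hai : a i = β (i.val / 2 - 1 + 2) := by
        rw [show i.val / 2 - 1 + 2 = i.val / 2 + 1 by omega]
        simp only [a, if_neg h0, if_neg h1]
      rw [hai]
      exact hβ _
  exact pdt_mul_eq_pdx hu hw (hG.comp (contDiff_pi.2 fun i => (ha i).1)) hwt
    (pdt_comp_eq hG (fun i => (ha i).1) fun i => (ha i).2)
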